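/- Let m ≥ 1 and let C be a unitary 2^m × 2^m complex matrix. Define the 2^{m+4} × 2^{m+4} unitary U = (|0⟩⟨0|)^{⊗4} ⊗ C + (I_{16} − (|0⟩⟨0|)^{⊗4}) ⊗ I_{2^m}. For r ∈ {1,2,3,4} let X^{(r)} = I_{2^{r−1}} ⊗ σx ⊗ I_{2^{4−r}} ⊗ I_{2^m}. Set W_j = X^{(1)} for all j ∈ {1, …, 8}, and V_1 = X^{(2)}, V_2 = X^{(3)}, V_3 = X^{(2)}, V_4 = X^{(4)}, V_5 = X^{(2)}, V_6 = X^{(3)}, V_7 = X^{(2)}, V_8 = X^{(4)}. Then (1/2^{m+4}) · Tr[(U W_1 U† V_1)(U W_2 U† V_2) ⋯ (U W_8 U† V_8)] = Re(Tr C)/2^m. -/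

import Mathlib

set_option linter.unusedSimpArgs false
open Matrix
open scoped Kronecker

/-- Pauli X matrix. -/
noncomputable def sigmaX : Matrix (Fin 2) (Fin 2) ℂ := !![0, 1; 1, 0]

/-- The projector |0⟩⟨0|. -/
noncomputable def ket0bra0 : Matrix (Fin 2) (Fin 2) ℂ := !![1, 0; 0, 0]

abbrev QA := Fin 2 × (Fin 2 × (Fin 2 × Fin 2))

/-- Shift-block matrices. -/
def GG {n : Type} (s : QA) (f : QA → Matrix n n ℂ) : Matrix (QA × n) (QA × n) ℂ :=
  Matrix.of fun p q => if p.1 = q.1 + s then f q.1 p.2 q.2 else 0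

lemma GG_mul {n : Type} [Fintype n] (s t : QA) (f g : QA → Matrix n n ℂ) :
    GG s f * GG t g = GG (t + s) (fun a => f (a + t) * g a) := by
  ext ⟨a, i⟩ ⟨b, j⟩
  simp only [GG, Matrix.mul_apply, Matrix.of_apply, Fintype.sum_prod_type (α₁ := QA)]
  rw [Finset.sum_eq_single (b + t)]
  · by_cases h : a = b + t + s
    · simp [h, add_assoc]
    · have h' : a ≠ b + (t + s) := by rwa [← add_assoc]
      simp [h, h']
  · intro c _ hc
    simp [hc]
  · simp

lemma GG_trace {n : Type} [Fintype n] (f : QA → Matrix n n ℂ) :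
    (GG 0 f).trace = ∑ a, (f a).trace := by
  simp only [Matrix.trace, Fintype.sum_prod_type (α₁ := QA), GG, Matrix.diag, Matrix.of_apply,
    add_zero, if_true]

lemma GG_conj {n : Type} (f : QA → Matrix n n ℂ) :
    (GG 0 f)ᴴ = GG 0 (fun a => (f a)ᴴ) := by
  ext ⟨a, i⟩ ⟨b, j⟩
  by_cases h : a = b
  · subst h; simp [GG]
  · have h' : b ≠ a := fun e => h e.symm
    simp [GG, h, h']

lemma fin2_cases (x : Fin 2) : x = 0 ∨ x = 1 := by fin_cases x <;> simp

lemma sX_apply (a b : Fin 2) : sigmaX a b = if a = b + 1 then 1 else 0 := by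
  fin_cases a <;> fin_cases b <;> simp [sigmaX]

lemma P_apply (a b : Fin 2) : ket0bra0 a b = if a = b ∧ b = 0 then 1 else 0 := by
  fin_cases a <;> fin_cases b <;> simp [ket0bra0]

lemma P4_apply (a b : QA) : (ket0bra0 ⊗ₖ (ket0bra0 ⊗ₖ (ket0bra0 ⊗ₖ ket0bra0))) a b
    = if a = b ∧ b = 0 then 1 else 0 := by
  obtain ⟨a1, a2, a3, a4⟩ := a
  obtain ⟨b1, b2, b3, b4⟩ := b
  simp only [Matrix.kroneckerMap_apply, P_apply, Prod.mk.injEq, Prod.mk_eq_zero,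
    ← ite_and, mul_ite, mul_one, mul_zero]
  congr 1
  simp only [eq_iff_iff]
  tauto

lemma GG_main (m : ℕ) (C : Matrix (Fin (2^m)) (Fin (2^m)) ℂ) :
    let U := GG 0 (fun a => if a = 0 then C else 1)
    let X1 : Matrix (QA × Fin (2^m)) (QA × Fin (2^m)) ℂ := GG (1, 0, 0, 0) (fun _ => 1)
    let X2 : Matrix (QA × Fin (2^m)) (QA × Fin (2^m)) ℂ := GG (0, 1, 0, 0) (fun _ => 1)
    let X3 : Matrix (QA × Fin (2^m)) (QA × Fin (2^m)) ℂ := GG (0, 0, 1, 0) (fun _ => 1)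
    let X4 : Matrix (QA × Fin (2^m)) (QA × Fin (2^m)) ℂ := GG (0, 0, 0, 1) (fun _ => 1)
    (1 / (2:ℂ)^(m+4)) *
        Matrix.trace
          ((U * X1 * Uᴴ * X2) * (U * X1 * Uᴴ * X3) * (U * X1 * Uᴴ * X2) * (U * X1 * Uᴴ * X4) *
           (U * X1 * Uᴴ * X2) * (U * X1 * Uᴴ * X3) * (U * X1 * Uᴴ * X2) * (U * X1 * Uᴴ * X4))
      = ((Matrix.trace C).re : ℂ) / (2:ℂ)^m := by
  intro U X1 X2 X3 X4
  simp only [U, X1, X2, X3, X4]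
  have e11 : (1 : Fin 2) + 1 = 0 := rfl
  have key : ∀ z : ℂ, z + star z = 2 * (z.re : ℂ) := fun z => by
    have := Complex.add_conj z
    simpa using this
  have hs := key C.trace
  simp only [GG_conj, GG_mul, Prod.mk_add_mk, add_zero, zero_add, e11]
  have h00 : ((0, 0, 0, 0) : QA) = 0 := rfl
  rw [h00, GG_trace]
  simp only [Fintype.sum_prod_type, Fin.sum_univ_two, Prod.mk_add_mk, add_zero, zero_add, e11,
    Prod.mk_eq_zero, one_ne_zero, and_true, and_false, true_and, false_and, if_true, if_false,
    and_self, Matrix.conjTranspose_one, mul_one, one_mul, Matrix.trace_conjTranspose]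
  rw [pow_add]
  field_simp
  linear_combination 8 * hs

/-- Appendix Example 5 (16-point OTOC reduction identity):
for `U = (|0⟩⟨0|)^{⊗4} ⊗ C + (I₁₆ − (|0⟩⟨0|)^{⊗4}) ⊗ I`,
`W_j = X^{(1)}` for all `j ∈ {1,…,8}`, and
`V₁ = X^{(2)}, V₂ = X^{(3)}, V₃ = X^{(2)}, V₄ = X^{(4)},
 V₅ = X^{(2)}, V₆ = X^{(3)}, V₇ = X^{(2)}, V₈ = X^{(4)}`,
`(1/2^{m+4}) Tr[(U W₁ U† V₁) ⋯ (U W₈ U† V₈)] = Re(Tr C)/2^m`. -/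
theorem sixteen_point_otoc_reduction (m : ℕ) (hm : 1 ≤ m)
    (C : Matrix (Fin (2^m)) (Fin (2^m)) ℂ)
    (hC : C ∈ Matrix.unitaryGroup (Fin (2^m)) ℂ) :
    let A := Fin 2 × (Fin 2 × (Fin 2 × Fin 2))
    let I2 : Matrix (Fin 2) (Fin 2) ℂ := 1
    let Im : Matrix (Fin (2^m)) (Fin (2^m)) ℂ := 1
    let P0000 : Matrix A A ℂ := ket0bra0 ⊗ₖ (ket0bra0 ⊗ₖ (ket0bra0 ⊗ₖ ket0bra0))
    let U : Matrix (A × Fin (2^m)) (A × Fin (2^m)) ℂ :=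
      P0000 ⊗ₖ C + ((1 : Matrix A A ℂ) - P0000) ⊗ₖ Im
    let X1 : Matrix (A × Fin (2^m)) (A × Fin (2^m)) ℂ := (sigmaX ⊗ₖ (I2 ⊗ₖ (I2 ⊗ₖ I2))) ⊗ₖ Im
    let X2 : Matrix (A × Fin (2^m)) (A × Fin (2^m)) ℂ := (I2 ⊗ₖ (sigmaX ⊗ₖ (I2 ⊗ₖ I2))) ⊗ₖ Im
    let X3 : Matrix (A × Fin (2^m)) (A × Fin (2^m)) ℂ := (I2 ⊗ₖ (I2 ⊗ₖ (sigmaX ⊗ₖ I2))) ⊗ₖ Im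
    let X4 : Matrix (A × Fin (2^m)) (A × Fin (2^m)) ℂ := (I2 ⊗ₖ (I2 ⊗ₖ (I2 ⊗ₖ sigmaX))) ⊗ₖ Im
    (1 / (2:ℂ)^(m+4)) *
        Matrix.trace
          ((U * X1 * Uᴴ * X2) * (U * X1 * Uᴴ * X3) * (U * X1 * Uᴴ * X2) * (U * X1 * Uᴴ * X4) *
           (U * X1 * Uᴴ * X2) * (U * X1 * Uᴴ * X3) * (U * X1 * Uᴴ * X2) * (U * X1 * Uᴴ * X4))
      = ((Matrix.trace C).re : ℂ) / (2:ℂ)^m := by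
  intro A I2 Im P0000 U X1 X2 X3 X4
  have hP : ∀ a b : A, P0000 a b = if a = b ∧ b = 0 then 1 else 0 := P4_apply
  have hU : U = GG 0 (fun a => if a = 0 then C else 1) := by
    ext ⟨a, i⟩ ⟨b, j⟩
    simp only [U, Im, GG, Matrix.add_apply, Matrix.sub_apply, Matrix.kroneckerMap_apply, hP,
      Matrix.of_apply, add_zero]
    by_cases h : a = b
    · subst h
      by_cases h0 : a = 0 <;> simp [h0]
    · simp [h]
  have h1 : X1 = GG (1, 0, 0, 0) (fun _ => 1) := by
    ext ⟨⟨a1, a2, a3, a4⟩, i⟩ ⟨⟨b1, b2, b3, b4⟩, j⟩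
    simp only [X1, I2, Im, GG, Matrix.kroneckerMap_apply, sX_apply, Matrix.of_apply,
      Matrix.one_apply, Prod.mk_add_mk, add_zero, Prod.mk.injEq, ite_and, ite_mul, mul_ite, mul_one, one_mul, mul_zero, zero_mul]
    split_ifs <;> rfl
  have h2 : X2 = GG (0, 1, 0, 0) (fun _ => 1) := by
    ext ⟨⟨a1, a2, a3, a4⟩, i⟩ ⟨⟨b1, b2, b3, b4⟩, j⟩
    simp only [X2, I2, Im, GG, Matrix.kroneckerMap_apply, sX_apply, Matrix.of_apply,
      Matrix.one_apply, Prod.mk_add_mk, add_zero, Prod.mk.injEq, ite_and, ite_mul, mul_ite, mul_one, one_mul, mul_zero, zero_mul]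
    split_ifs <;> rfl
  have h3 : X3 = GG (0, 0, 1, 0) (fun _ => 1) := by
    ext ⟨⟨a1, a2, a3, a4⟩, i⟩ ⟨⟨b1, b2, b3, b4⟩, j⟩
    simp only [X3, I2, Im, GG, Matrix.kroneckerMap_apply, sX_apply, Matrix.of_apply,
      Matrix.one_apply, Prod.mk_add_mk, add_zero, Prod.mk.injEq, ite_and, ite_mul, mul_ite, mul_one, one_mul, mul_zero, zero_mul]
    split_ifs <;> rfl
  have h4 : X4 = GG (0, 0, 0, 1) (fun _ => 1) := by
    ext ⟨⟨a1, a2, a3, a4⟩, i⟩ ⟨⟨b1, b2, b3, b4⟩, j⟩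
    simp only [X4, I2, Im, GG, Matrix.kroneckerMap_apply, sX_apply, Matrix.of_apply,
      Matrix.one_apply, Prod.mk_add_mk, add_zero, Prod.mk.injEq, ite_and, ite_mul, mul_ite, mul_one, one_mul, mul_zero, zero_mul]
    split_ifs <;> rfl
  clear_value U X1 X2 X3 X4
  subst hU h1 h2 h3 h4
  exact GG_main m C
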